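/- (Moutard transformation for the Dirac operator.) Let Ω ⊆ ℂ be open and simply connected, U: Ω → ℂ smooth. Let ψ⁰, ψ satisfy ∂̄ψ₁ = conj(U)ψ₂, ∂ψ₂ = −Uψ₁ and let φ⁰ satisfy ∂̄φ₁ = Uφ₂, ∂φ₂ = −conj(U)φ₁ (all smooth on Ω). For a pair (φ', ψ') write M(φ',ψ') = i·[[ψ'₁conj(φ'₂), −conj(ψ'₂)conj(φ'₂)], [ψ'₁φ'₁, −conj(ψ'₂)φ'₁]] and N(φ',ψ') = i·[[ψ'₂conj(φ'₁), conj(ψ'₁)conj(φ'₁)], [−ψ'₂φ'₂, −conj(ψ'₁)φ'₂]]. Suppose S₀: Ω → M₂(ℂ) is smooth, invertible at every point, quaternion-valued (of the form [[s, −conj(t)], [t, conj(s)]]), with ∂S₀ = M(φ⁰,ψ⁰) and ∂̄S₀ = N(φ⁰,ψ⁰); and S₁: Ω → M₂(ℂ) is smooth, quaternion-valued, with ∂S₁ = M(φ⁰,ψ) and ∂̄S₁ = N(φ⁰,ψ). Set Ψ₀ = [[ψ⁰₁, −conj(ψ⁰₂)], [ψ⁰₂, conj(ψ⁰₁)]],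 Φ₀ = [[φ⁰₁, −conj(φ⁰₂)], [φ⁰₂, conj(φ⁰₁)]], Ψ = [[ψ₁, −conj(ψ₂)], [ψ₂, conj(ψ₁)]], Γ = [[0, 1], [−1, 0]], K = Ψ₀·S₀⁻¹·Γ·Φ₀^T·Γ⁻¹ (T the ordinary transpose), and W = i·K₂₂, Ũ = U + W. Then Ψ̃ = Ψ − Ψ₀·S₀⁻¹·S₁ satisfies the Dirac equation with potential Ũ: for each column j = 1, 2, ∂Ψ̃₂ⱼ + ŨΨ̃₁ⱼ = 0 and ∂̄Ψ̃₁ⱼ = conj(Ũ)Ψ̃₂ⱼ on Ω. -/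

import Mathlib

open ComplexConjugate Matrix

/-- The Wirtinger derivative `∂g = (∂g/∂x − i ∂g/∂y)/2` of `g : ℂ → ℂ`. -/
noncomputable def wdz (g : ℂ → ℂ) (z : ℂ) : ℂ :=
  (fderiv ℝ g z 1 - Complex.I * fderiv ℝ g z Complex.I) / 2

/-- The Wirtinger derivative `∂̄g = (∂g/∂x + i ∂g/∂y)/2` of `g : ℂ → ℂ`. -/
noncomputable def wdzbar (g : ℂ → ℂ) (z : ℂ) : ℂ :=
  (fderiv ℝ g z 1 + Complex.I * fderiv ℝ g z Complex.I) / 2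

/-- The matrix `M(φ', ψ') = i·[[ψ'₁conj(φ'₂), −conj(ψ'₂)conj(φ'₂)], [ψ'₁φ'₁, −conj(ψ'₂)φ'₁]]`
(the `dz`-part of the form `ω(Φ', Ψ')` integrated to `S(Φ', Ψ')`). -/
noncomputable def Mmat (φ'₁ φ'₂ ψ'₁ ψ'₂ : ℂ → ℂ) (z : ℂ) : Matrix (Fin 2) (Fin 2) ℂ :=
  Complex.I •
    !![ψ'₁ z * conj (φ'₂ z), -(conj (ψ'₂ z) * conj (φ'₂ z));
       ψ'₁ z * φ'₁ z, -(conj (ψ'₂ z) * φ'₁ z)]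

/-- The matrix `N(φ', ψ') = i·[[ψ'₂conj(φ'₁), conj(ψ'₁)conj(φ'₁)], [−ψ'₂φ'₂, −conj(ψ'₁)φ'₂]]`
(the `dz̄`-part of the form `ω(Φ', Ψ')`). -/
noncomputable def Nmat (φ'₁ φ'₂ ψ'₁ ψ'₂ : ℂ → ℂ) (z : ℂ) : Matrix (Fin 2) (Fin 2) ℂ :=
  Complex.I •
    !![ψ'₂ z * conj (φ'₁ z), conj (ψ'₁ z) * conj (φ'₁ z);
       -(ψ'₂ z * φ'₂ z), -(conj (ψ'₁ z) * φ'₂ z)]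

/-- A 2×2 complex matrix is quaternion-valued if it has the form
`[[s, −conj t], [t, conj s]]`. -/
def IsQuat (A : Matrix (Fin 2) (Fin 2) ℂ) : Prop :=
  A 1 1 = conj (A 0 0) ∧ A 0 1 = -conj (A 1 0)

/-- Common form of both Wirtinger derivatives. -/
noncomputable def wdc (c : ℂ) (g : ℂ → ℂ) (z : ℂ) : ℂ :=
  (fderiv ℝ g z 1 + c * fderiv ℝ g z Complex.I) / 2

theorem wdz_eq (g : ℂ → ℂ) (z : ℂ) : wdz g z = wdc (-Complex.I) g z := by
  simp only [wdz, wdc]; ring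

theorem wdzbar_eq (g : ℂ → ℂ) (z : ℂ) : wdzbar g z = wdc Complex.I g z := rfl

theorem wdc_add (c : ℂ) {f g : ℂ → ℂ} {z : ℂ} (hf : DifferentiableAt ℝ f z)
    (hg : DifferentiableAt ℝ g z) :
    wdc c (fun w => f w + g w) z = wdc c f z + wdc c g z := by
  simp only [wdc, fderiv_fun_add hf hg, _root_.add_apply]; ring

theorem wdc_sub (c : ℂ) {f g : ℂ → ℂ} {z : ℂ} (hf : DifferentiableAt ℝ f z)
    (hg : DifferentiableAt ℝ g z) :
    wdc c (fun w => f w - g w) z = wdc c f z - wdc c g z := by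
  simp only [wdc, fderiv_fun_sub hf hg, _root_.sub_apply]; ring

theorem wdc_mul (c : ℂ) {f g : ℂ → ℂ} {z : ℂ} (hf : DifferentiableAt ℝ f z)
    (hg : DifferentiableAt ℝ g z) :
    wdc c (fun w => f w * g w) z = f z * wdc c g z + wdc c f z * g z := by
  simp only [wdc, fderiv_fun_mul hf hg, _root_.add_apply,
    _root_.smul_apply, smul_eq_mul]; ring

theorem wdc_neg (c : ℂ) (f : ℂ → ℂ) (z : ℂ) :
    wdc c (fun w => - f w) z = - wdc c f z := by
  simp only [wdc, fderiv_fun_neg, _root_.neg_apply]; ring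

theorem diff_conj {f : ℂ → ℂ} {z : ℂ} (hf : DifferentiableAt ℝ f z) :
    DifferentiableAt ℝ (fun w => conj (f w)) z :=
  (Complex.conjCLE.differentiableAt).comp z hf

theorem wdc_conj (c : ℂ) {f : ℂ → ℂ} {z : ℂ} (hf : DifferentiableAt ℝ f z) :
    wdc c (fun w => conj (f w)) z = conj (wdc (conj c) f z) := by
  have h : HasFDerivAt (fun w => conj (f w))
      ((Complex.conjCLE : ℂ →L[ℝ] ℂ).comp (fderiv ℝ f z)) z :=
    ((Complex.conjCLE : ℂ →L[ℝ] ℂ).hasFDerivAt).comp z hf.hasFDerivAt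
  simp [wdc, h.fderiv, map_ofNat]

theorem core (c : ℂ) (z : ℂ) (q p0 p1 : ℂ → ℂ) (S₀ S₁ : ℂ → Matrix (Fin 2) (Fin 2) ℂ)
    (hq : DifferentiableAt ℝ q z) (hp0 : DifferentiableAt ℝ p0 z)
    (hp1 : DifferentiableAt ℝ p1 z)
    (h0 : ∀ i j, DifferentiableAt ℝ (fun w => S₀ w i j) z)
    (h1 : ∀ i j, DifferentiableAt ℝ (fun w => S₁ w i j) z)
    (hu : ∀ᶠ w in nhds z, IsUnit (S₀ w)) (D₀ D₁ : Matrix (Fin 2) (Fin 2) ℂ)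
    (hD₀ : ∀ i j, wdc c (fun w => S₀ w i j) z = D₀ i j)
    (hD₁ : ∀ i j, wdc c (fun w => S₁ w i j) z = D₁ i j) (j : Fin 2) :
    wdc c (fun w => q w - (p0 w * ((S₀ w)⁻¹ * S₁ w) 0 j + p1 w * ((S₀ w)⁻¹ * S₁ w) 1 j)) z
      = wdc c q z
        - (wdc c p0 z * ((S₀ z)⁻¹ * S₁ z) 0 j + wdc c p1 z * ((S₀ z)⁻¹ * S₁ z) 1 j)
        - (p0 z * ((S₀ z)⁻¹ * (D₁ - D₀ * ((S₀ z)⁻¹ * S₁ z))) 0 j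
          + p1 z * ((S₀ z)⁻¹ * (D₁ - D₀ * ((S₀ z)⁻¹ * S₁ z))) 1 j) := by
  have hz : IsUnit (S₀ z) := hu.self_of_nhds
  have hzd : IsUnit (S₀ z).det := (Matrix.isUnit_iff_isUnit_det _).1 hz
  have hdet : DifferentiableAt ℝ (fun w => (S₀ w).det) z := by
    simp only [Matrix.det_fin_two]
    exact ((h0 0 0).mul (h0 1 1)).sub ((h0 0 1).mul (h0 1 0))
  have hinv : ∀ i k, DifferentiableAt ℝ (fun w => (S₀ w)⁻¹ i k) z := by
    intro i k
    have hd := hdet.inv hzd.ne_zero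
    simp only [Matrix.inv_def, Ring.inverse_eq_inv', Matrix.smul_apply, smul_eq_mul,
      Matrix.adjugate_fin_two]
    refine hd.mul ?_
    fin_cases i <;> fin_cases k <;> simp [h0]
  have hC : ∀ i k, DifferentiableAt ℝ (fun w => ((S₀ w)⁻¹ * S₁ w) i k) z := by
    intro i k
    simp only [Matrix.mul_apply, Fin.sum_univ_two]
    exact ((hinv _ _).mul (h1 _ _)).add ((hinv _ _).mul (h1 _ _))
  have key : ∀ i, D₁ i j = S₀ z i 0 * wdc c (fun w => ((S₀ w)⁻¹ * S₁ w) 0 j) z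
      + D₀ i 0 * ((S₀ z)⁻¹ * S₁ z) 0 j
      + (S₀ z i 1 * wdc c (fun w => ((S₀ w)⁻¹ * S₁ w) 1 j) z
      + D₀ i 1 * ((S₀ z)⁻¹ * S₁ z) 1 j) := by
    intro i
    rw [← hD₁, ← hD₀, ← hD₀, ← wdc_mul c (h0 i 0) (hC 0 j), ← wdc_mul c (h0 i 1) (hC 1 j),
      ← wdc_add c ((h0 i 0).fun_mul (hC 0 j)) ((h0 i 1).fun_mul (hC 1 j))]
    have he : (fun w => S₁ w i j) =ᶠ[nhds z] (fun w => S₀ w i 0 * ((S₀ w)⁻¹ * S₁ w) 0 j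
        + S₀ w i 1 * ((S₀ w)⁻¹ * S₁ w) 1 j) := by
      filter_upwards [hu] with w hw
      have : S₁ w = S₀ w * ((S₀ w)⁻¹ * S₁ w) := by
        rw [Matrix.mul_nonsing_inv_cancel_left _ _ ((Matrix.isUnit_iff_isUnit_det _).1 hw)]
      conv_lhs => rw [this]
      rw [Matrix.mul_apply, Fin.sum_univ_two]
    simp only [wdc, he.fderiv_eq]
  set v : Fin 2 → ℂ := fun k => wdc c (fun w => ((S₀ w)⁻¹ * S₁ w) k j) z with hv
  have hcol : ∀ k, ((S₀ z)⁻¹ * (D₁ - D₀ * ((S₀ z)⁻¹ * S₁ z))) k j = v k := by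
    intro k
    have e1 : (fun i => (D₁ - D₀ * ((S₀ z)⁻¹ * S₁ z)) i j) = S₀ z *ᵥ v := by
      ext i
      rw [Matrix.sub_apply, Matrix.mul_apply, key i]
      simp only [Matrix.mulVec, dotProduct, Fin.sum_univ_two, hv]
      ring
    have e2 : ((S₀ z)⁻¹ * (D₁ - D₀ * ((S₀ z)⁻¹ * S₁ z))) k j
        = ((S₀ z)⁻¹ *ᵥ (fun i => (D₁ - D₀ * ((S₀ z)⁻¹ * S₁ z)) i j)) k := by
      rw [Matrix.mul_apply]; rfl
    rw [e2, e1, Matrix.mulVec_mulVec, Matrix.nonsing_inv_mul _ hzd, Matrix.one_mulVec]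
  rw [hcol, hcol, wdc_sub c hq ((hp0.fun_mul (hC 0 j)).fun_add (hp1.fun_mul (hC 1 j))),
    wdc_add c (hp0.fun_mul (hC 0 j)) (hp1.fun_mul (hC 1 j)), wdc_mul c hp0 (hC 0 j),
    wdc_mul c hp1 (hC 1 j)]
  simp only [hv]
  ring

theorem quat_inv (A : Matrix (Fin 2) (Fin 2) ℂ) (h : IsQuat A) : IsQuat A⁻¹ := by
  obtain ⟨h1, h2⟩ := h
  have hd : conj A.det = A.det := by
    rw [Matrix.det_fin_two, h1, h2]; simp; ring
  have hd' : conj (A.det⁻¹) = A.det⁻¹ := by rw [map_inv₀, hd]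
  constructor
  · simp only [Matrix.inv_def, Ring.inverse_eq_inv', Matrix.smul_apply, smul_eq_mul,
      Matrix.adjugate_fin_two, map_mul, hd']
    simp [h1]
  · simp only [Matrix.inv_def, Ring.inverse_eq_inv', Matrix.smul_apply, smul_eq_mul,
      Matrix.adjugate_fin_two, map_mul, hd']
    simp [h2]

/-- the Moutard transformation for the Dirac operator. Given solutions
`ψ⁰, ψ` of `Dψ = 0` and `φ⁰` of `D^∨φ = 0` with potential `U`, and quaternion-valued
primitives `S₀` of `ω(Φ₀, Ψ₀)` (invertible) and `S₁` of `ω(Φ₀, Ψ)`, the matrix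
`Ψ̃ = Ψ − Ψ₀ S₀⁻¹ S₁` solves the Dirac equation with the new potential
`Ũ = U + W`, where `W = i·K₂₂` and `K = Ψ₀ S₀⁻¹ Γ Φ₀^T Γ⁻¹`. -/
theorem stmt10 (Ω : Set ℂ) (hΩ : IsOpen Ω) (hsc : SimplyConnectedSpace Ω)
    (U : ℂ → ℂ) (hU : ContDiffOn ℝ (⊤ : ℕ∞) U Ω)
    (ψ01 ψ02 ψ1 ψ2 φ01 φ02 : ℂ → ℂ)
    (hψ01 : ContDiffOn ℝ (⊤ : ℕ∞) ψ01 Ω) (hψ02 : ContDiffOn ℝ (⊤ : ℕ∞) ψ02 Ω)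
    (hψ1 : ContDiffOn ℝ (⊤ : ℕ∞) ψ1 Ω) (hψ2 : ContDiffOn ℝ (⊤ : ℕ∞) ψ2 Ω)
    (hφ01 : ContDiffOn ℝ (⊤ : ℕ∞) φ01 Ω) (hφ02 : ContDiffOn ℝ (⊤ : ℕ∞) φ02 Ω)
    (hψ0a : ∀ z ∈ Ω, wdzbar ψ01 z = conj (U z) * ψ02 z)
    (hψ0b : ∀ z ∈ Ω, wdz ψ02 z = -U z * ψ01 z)
    (hψa : ∀ z ∈ Ω, wdzbar ψ1 z = conj (U z) * ψ2 z)
    (hψb : ∀ z ∈ Ω, wdz ψ2 z = -U z * ψ1 z)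
    (hφ0a : ∀ z ∈ Ω, wdzbar φ01 z = U z * φ02 z)
    (hφ0b : ∀ z ∈ Ω, wdz φ02 z = -conj (U z) * φ01 z)
    (S₀ S₁ : ℂ → Matrix (Fin 2) (Fin 2) ℂ)
    (hS₀sm : ∀ i j : Fin 2, ContDiffOn ℝ (⊤ : ℕ∞) (fun z => S₀ z i j) Ω)
    (hS₁sm : ∀ i j : Fin 2, ContDiffOn ℝ (⊤ : ℕ∞) (fun z => S₁ z i j) Ω)
    (hS₀inv : ∀ z ∈ Ω, IsUnit (S₀ z))
    (hS₀quat : ∀ z ∈ Ω, IsQuat (S₀ z))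
    (hS₁quat : ∀ z ∈ Ω, IsQuat (S₁ z))
    (hS₀dz : ∀ z ∈ Ω, ∀ i j : Fin 2,
      wdz (fun w => S₀ w i j) z = Mmat φ01 φ02 ψ01 ψ02 z i j)
    (hS₀dzbar : ∀ z ∈ Ω, ∀ i j : Fin 2,
      wdzbar (fun w => S₀ w i j) z = Nmat φ01 φ02 ψ01 ψ02 z i j)
    (hS₁dz : ∀ z ∈ Ω, ∀ i j : Fin 2,
      wdz (fun w => S₁ w i j) z = Mmat φ01 φ02 ψ1 ψ2 z i j)
    (hS₁dzbar : ∀ z ∈ Ω, ∀ i j : Fin 2,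
      wdzbar (fun w => S₁ w i j) z = Nmat φ01 φ02 ψ1 ψ2 z i j)
    (Ψ₀ Φ₀ Ψ K Ψt : ℂ → Matrix (Fin 2) (Fin 2) ℂ) (W Ut : ℂ → ℂ)
    (hΨ₀ : Ψ₀ = fun z => !![ψ01 z, -conj (ψ02 z); ψ02 z, conj (ψ01 z)])
    (hΦ₀ : Φ₀ = fun z => !![φ01 z, -conj (φ02 z); φ02 z, conj (φ01 z)])
    (hΨ : Ψ = fun z => !![ψ1 z, -conj (ψ2 z); ψ2 z, conj (ψ1 z)])
    (hK : K = fun z => Ψ₀ z * (S₀ z)⁻¹ * !![(0 : ℂ), 1; -1, 0] * (Φ₀ z)ᵀ *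
      (!![(0 : ℂ), 1; -1, 0])⁻¹)
    (hW : W = fun z => Complex.I * K z 1 1)
    (hUt : Ut = fun z => U z + W z)
    (hΨt : Ψt = fun z => Ψ z - Ψ₀ z * (S₀ z)⁻¹ * S₁ z) :
    ∀ z ∈ Ω, ∀ j : Fin 2,
      wdz (fun w => Ψt w 1 j) z + Ut z * Ψt z 0 j = 0 ∧
      wdzbar (fun w => Ψt w 0 j) z = conj (Ut z) * Ψt z 1 j := by
  intro z hz j
  have hn : Ω ∈ nhds z := hΩ.mem_nhds hz
  have dif : ∀ {f : ℂ → ℂ}, ContDiffOn ℝ (⊤ : ℕ∞) f Ω → DifferentiableAt ℝ f z := fun h =>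
    (h.contDiffAt hn).differentiableAt (by simp)
  have hu : ∀ᶠ w in nhds z, IsUnit (S₀ w) := by
    filter_upwards [hn] with w hw using hS₀inv w hw
  have d01 := dif hψ01
  have d02 := dif hψ02
  have d1 := dif hψ1
  have d2 := dif hψ2
  have hG : (!![(0 : ℂ), 1; -1, 0])⁻¹ = !![(0 : ℂ), -1; 1, 0] := by
    apply Matrix.inv_eq_right_inv
    ext i j
    fin_cases i <;> fin_cases j <;> simp
  obtain ⟨hA1, hA2⟩ := quat_inv _ (hS₀quat z hz)
  have e01 := hψ0a z hz
  have e02 := hψ0b z hz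
  have e1 := hψa z hz
  have e2 := hψb z hz
  rw [wdzbar_eq] at e01 e1
  rw [wdz_eq] at e02 e2
  have c01 : wdc (-Complex.I) (fun w => conj (ψ01 w)) z = U z * conj (ψ02 z) := by
    rw [wdc_conj _ d01]; simp [e01]
  have c1 : wdc (-Complex.I) (fun w => conj (ψ1 w)) z = U z * conj (ψ2 z) := by
    rw [wdc_conj _ d1]; simp [e1]
  have c02 : wdc Complex.I (fun w => -conj (ψ02 w)) z = conj (U z) * conj (ψ01 z) := by
    rw [wdc_neg, wdc_conj _ d02]; simp [e02]
  have c2 : wdc Complex.I (fun w => -conj (ψ2 w)) z = conj (U z) * conj (ψ1 z) := by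
    rw [wdc_neg, wdc_conj _ d2]; simp [e2]
  have hI := Complex.I_mul_I
  have row : ∀ w i j, Ψt w i j = Ψ w i j - (Ψ₀ w i 0 * ((S₀ w)⁻¹ * S₁ w) 0 j
      + Ψ₀ w i 1 * ((S₀ w)⁻¹ * S₁ w) 1 j) := by
    intro w i j
    rw [hΨt]
    simp only [Matrix.mul_assoc, Matrix.sub_apply]
    rw [Matrix.mul_apply (M := Ψ₀ w), Fin.sum_univ_two]
  have dS0 : ∀ i j, DifferentiableAt ℝ (fun w => S₀ w i j) z := fun i j => dif (hS₀sm i j)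
  have dS1 : ∀ i j, DifferentiableAt ℝ (fun w => S₁ w i j) z := fun i j => dif (hS₁sm i j)
  have k1 := fun q hq => core (-Complex.I) z q (fun w => ψ02 w) (fun w => conj (ψ01 w)) S₀ S₁ hq
    d02 (diff_conj d01) dS0 dS1 hu _ _
    (fun i j => (wdz_eq _ _).symm.trans (hS₀dz z hz i j))
    (fun i j => (wdz_eq _ _).symm.trans (hS₁dz z hz i j)) j
  have k2 := fun q hq => core Complex.I z q (fun w => ψ01 w) (fun w => -conj (ψ02 w)) S₀ S₁ hq
    d01 (diff_conj d02).fun_neg dS0 dS1 hu _ _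
    (fun i j => (wdzbar_eq _ _).symm.trans (hS₀dzbar z hz i j))
    (fun i j => (wdzbar_eq _ _).symm.trans (hS₁dzbar z hz i j)) j
  rw [wdz_eq, wdzbar_eq]
  simp only [row, hUt, hW, hK, hG]
  constructor
  · fin_cases j
    · have := k1 _ d2
      rw [e2, e02, c01] at this
      simp only [hΨ, hΨ₀, hΦ₀]
      simp only [Matrix.mul_apply, Matrix.sub_apply, Fin.sum_univ_two, Mmat] at this ⊢
      simp at this ⊢
      rw [this]
      skip
      ring
    · have := k1 _ (diff_conj d1)
      rw [c1, e02, c01] at this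
      simp only [hΨ, hΨ₀, hΦ₀]
      simp only [Matrix.mul_apply, Matrix.sub_apply, Fin.sum_univ_two, Mmat] at this ⊢
      simp at this ⊢
      rw [this]
      skip
      ring
  · fin_cases j
    · have := k2 _ d1
      rw [e1, e01, c02] at this
      simp only [hΨ, hΨ₀, hΦ₀]
      simp only [Matrix.mul_apply, Matrix.sub_apply, Fin.sum_univ_two, Nmat] at this ⊢
      simp at this ⊢
      rw [this]
      simp [hA1, hA2]
      ring
    · have := k2 _ (diff_conj d2).fun_neg
      rw [c2, e01, c02] at this
      simp only [hΨ, hΨ₀, hΦ₀]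
      simp only [Matrix.mul_apply, Matrix.sub_apply, Fin.sum_univ_two, Nmat] at this ⊢
      simp at this ⊢
      rw [this]
      simp [hA1, hA2]
      ring
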